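/- Let f : 2^U → ℝ≥0 be a monotone submodular set function on a finite set U, and let F be its multilinear extension. Then for every subset S ⊆ U, every t ∈ [0,1], and every subset T ⊆ U, we have ∑_{i ∈ T} ∇_i F(t·1_S) ≥ f(T) − F(t·1_S), where ∇_i F denotes the i-th partial derivative of F. -/

import Mathlib

open Finset

/-- The multilinear extension of a set function. -/
noncomputable def multilinear {U : Type*} [Fintype U] [DecidableEq U]
    (f : Finset U → ℝ) (x : U → ℝ) : ℝ :=
  ∑ S : Finset U, f S * (∏ i ∈ S, x i) * ∏ i ∈ Sᶜ, (1 - x i)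

/-- The partial derivative of the multilinear extension in coordinate `i`. -/
noncomputable def gradF {U : Type*} [Fintype U] [DecidableEq U]
    (f : Finset U → ℝ) (i : U) (x : U → ℝ) : ℝ :=
  multilinear f (Function.update x i 1) - multilinear f (Function.update x i 0)

/-- Conditioning the multilinear extension on whether `i` is chosen. -/
lemma multilinear_eq_sum_erase {U : Type*} [Fintype U] [DecidableEq U]
    (f : Finset U → ℝ) (x : U → ℝ) (i : U) :
    multilinear f x = ∑ R ∈ (univ.erase i).powerset,
      ((1 - x i) * f R + x i * f (insert i R)) *
        ((∏ j ∈ R, x j) * ∏ j ∈ univ.erase i \ R, (1 - x j)) := by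
  have huniv : (univ : Finset (Finset U)) = (insert i (univ.erase i)).powerset := by
    rw [insert_erase (mem_univ i), powerset_univ]
  rw [multilinear, huniv, sum_powerset_insert (notMem_erase i univ), ← sum_add_distrib]
  refine sum_congr rfl fun R hR => ?_
  have hi : i ∉ R := fun h => notMem_erase i univ (mem_powerset.1 hR h)
  have hcompl : Rᶜ = insert i (univ.erase i \ R) := by
    ext j
    by_cases hj : j = i <;> simp [hj, hi]
  have hcompl_insert : (insert i R)ᶜ = univ.erase i \ R := by
    ext j
    by_cases hj : j = i <;> simp [hj]
  rw [hcompl_insert, hcompl, prod_insert (by simp), prod_insert hi]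
  ring

lemma multilinear_update {U : Type*} [Fintype U] [DecidableEq U]
    (f : Finset U → ℝ) (x : U → ℝ) (i : U) (c : ℝ) :
    multilinear f (Function.update x i c) =
      multilinear (fun R => (1 - c) * f (R.erase i) + c * f (insert i R)) x := by
  rw [multilinear_eq_sum_erase _ _ i, multilinear_eq_sum_erase _ x i]
  refine sum_congr rfl fun R hR => ?_
  have hi : i ∉ R := fun h => notMem_erase i univ (mem_powerset.1 hR h)
  have hout : ∏ j ∈ univ.erase i \ R, (1 - Function.update x i c j) =
      ∏ j ∈ univ.erase i \ R, (1 - x j) := prod_congr rfl fun j hj => by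
    rw [Function.update_of_ne (ne_of_mem_erase (mem_sdiff.1 hj).1)]
  rw [prod_update_of_notMem hi, hout]
  simp only [Function.update_self, erase_eq_of_notMem hi, erase_insert hi, insert_idem]
  ring

lemma multilinear_mono {U : Type*} [Fintype U] [DecidableEq U]
    {f g : Finset U → ℝ} (hfg : ∀ R, f R ≤ g R) {x : U → ℝ}
    (hx0 : ∀ i, 0 ≤ x i) (hx1 : ∀ i, x i ≤ 1) : multilinear f x ≤ multilinear g x := by
  refine sum_le_sum fun R _ => ?_
  have hout : 0 ≤ ∏ i ∈ Rᶜ, (1 - x i) := prod_nonneg fun i _ => sub_nonneg.2 (hx1 i)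
  have hin : 0 ≤ ∏ i ∈ R, x i := prod_nonneg fun i _ => hx0 i
  gcongr
  exact hfg R

lemma multilinear_const {U : Type*} [Fintype U] [DecidableEq U] (c : ℝ) (x : U → ℝ) :
    multilinear (fun _ => c) x = c := by
  have h := prod_add x (fun i => 1 - x i) univ
  simp only [add_sub_cancel, prod_const_one, powerset_univ, ← compl_eq_univ_sdiff] at h
  simp only [multilinear, mul_assoc, ← mul_sum, ← h, mul_one]

lemma multilinear_sub {U : Type*} [Fintype U] [DecidableEq U]
    (f g : Finset U → ℝ) (x : U → ℝ) :
    multilinear (fun R => f R - g R) x = multilinear f x - multilinear g x := by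
  simp only [multilinear, sub_mul, sum_sub_distrib]

lemma multilinear_sum {U ι : Type*} [Fintype U] [DecidableEq U]
    (s : Finset ι) (f : ι → Finset U → ℝ) (x : U → ℝ) :
    multilinear (fun R => ∑ k ∈ s, f k R) x = ∑ k ∈ s, multilinear (f k) x := by
  simp only [multilinear, sum_mul]
  exact sum_comm

lemma gradF_eq_multilinear {U : Type*} [Fintype U] [DecidableEq U]
    (f : Finset U → ℝ) (i : U) (x : U → ℝ) :
    gradF f i x = multilinear (fun R => f (insert i R) - f (R.erase i)) x := by
  simp [gradF, multilinear_update, multilinear_sub]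

lemma union_sub_le_sum_marginals {U : Type*} [DecidableEq U] {f : Finset U → ℝ}
    (hmono : ∀ S T : Finset U, S ⊆ T → f S ≤ f T)
    (hsub : ∀ S T : Finset U, S ⊆ T → ∀ i ∉ T,
      f (insert i T) - f T ≤ f (insert i S) - f S)
    (R T : Finset U) : f (R ∪ T) - f R ≤ ∑ i ∈ T, (f (insert i R) - f R) := by
  induction T using Finset.induction_on with
  | empty => simp
  | insert a T ha ih =>
    rw [sum_insert ha, union_insert]
    by_cases h : a ∈ R ∪ T
    · rw [insert_eq_of_mem h]
      linarith [hmono R (insert a R) (subset_insert a R)]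
    · linarith [hsub R (R ∪ T) subset_union_left a h]

theorem stmt0 {U : Type*} [Fintype U] [DecidableEq U]
    (f : Finset U → ℝ) (hf0 : ∀ S, 0 ≤ f S)
    (hmono : ∀ S T : Finset U, S ⊆ T → f S ≤ f T)
    (hsub : ∀ S T : Finset U, S ⊆ T → ∀ i ∉ T,
      f (insert i T) - f T ≤ f (insert i S) - f S)
    (S T : Finset U) (t : ℝ) (ht : t ∈ Set.Icc (0:ℝ) 1) :
    f T - multilinear f (fun i => if i ∈ S then t else 0)
      ≤ ∑ i ∈ T, gradF f i (fun i => if i ∈ S then t else 0) := by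
  simp only [gradF_eq_multilinear]
  rw [← multilinear_sum]
  nth_rewrite 1 [← multilinear_const (f T) (fun i => if i ∈ S then t else 0)]
  rw [← multilinear_sub]
  refine multilinear_mono (fun R => ?_) (fun i => ?_) (fun i => ?_)
  · calc f T - f R ≤ f (R ∪ T) - f R := sub_le_sub_right (hmono _ _ subset_union_right) _
      _ ≤ ∑ i ∈ T, (f (insert i R) - f R) := union_sub_le_sum_marginals hmono hsub R T
      _ ≤ ∑ i ∈ T, (f (insert i R) - f (R.erase i)) :=
        sum_le_sum fun i _ => sub_le_sub_left (hmono _ _ (erase_subset i R)) _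
  · split_ifs
    exacts [ht.1, le_rfl]
  · split_ifs
    exacts [ht.2, zero_le_one]
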